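/- Let a, b, c, d be integers with ad - bc = 1 and let G be the group presented by generators x, y, z and relations x*y = y*x, z*x*z⁻¹ = x^a * y^b, z*y*z⁻¹ = x^c * y^d. Then the abelianization of G is isomorphic to ℤ ⊕ (ℤ² / (U - I)ℤ²), where U is the integer matrix [[a,b],[c,d]] and (U - I)ℤ² denotes the image of the linear map U - I on ℤ². -/

import Mathlib

/-- The relators of the group `ℤ² ⋊ ℤ` presented by the integers `a`, `b`, `c`, `d`. -/
abbrev torusBundleRels (a b c d : ℤ) : Set (FreeGroup (Fin 3)) :=
  {FreeGroup.of 0 * FreeGroup.of 1 * (FreeGroup.of 1 * FreeGroup.of 0)⁻¹,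
    FreeGroup.of 2 * FreeGroup.of 0 * (FreeGroup.of 2)⁻¹ *
      ((FreeGroup.of 0) ^ a * (FreeGroup.of 1) ^ b)⁻¹,
    FreeGroup.of 2 * FreeGroup.of 1 * (FreeGroup.of 2)⁻¹ *
      ((FreeGroup.of 0) ^ c * (FreeGroup.of 1) ^ d)⁻¹}

namespace torusBundleRels

/-- The cokernel of `U - 1` acting on column vectors. -/
abbrev Coker (a b c d : ℤ) : Type :=
  (Fin 2 → ℤ) ⧸ LinearMap.range (Matrix.toLin' (!![a, b; c, d] - 1))

/-- The class of a generator in the abelianization, written additively. -/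
def gen (a b c d : ℤ) (i : Fin 3) :
    Additive (Abelianization (PresentedGroup (torusBundleRels a b c d))) :=
  Additive.ofMul (Abelianization.of (PresentedGroup.of i))

lemma gen_rel_zero (a b c d : ℤ) :
    (a - 1) • gen a b c d 0 + b • gen a b c d 1 = 0 := by
  have h := congrArg (fun g => Additive.ofMul (Abelianization.of g))
    (PresentedGroup.one_of_mem (rels := torusBundleRels a b c d) (Or.inr (Or.inl rfl)))
  simp only [map_mul, map_inv, map_zpow, map_one, ofMul_mul, ofMul_inv, ofMul_zpow, ofMul_one] at h
  change gen a b c d 2 + gen a b c d 0 + -gen a b c d 2 +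
    -(a • gen a b c d 0 + b • gen a b c d 1) = 0 at h
  linear_combination (norm := module) (-1 : ℤ) • h

lemma gen_rel_one (a b c d : ℤ) :
    c • gen a b c d 0 + (d - 1) • gen a b c d 1 = 0 := by
  have h := congrArg (fun g => Additive.ofMul (Abelianization.of g))
    (PresentedGroup.one_of_mem (rels := torusBundleRels a b c d) (Or.inr (Or.inr rfl)))
  simp only [map_mul, map_inv, map_zpow, map_one, ofMul_mul, ofMul_inv, ofMul_zpow, ofMul_one] at h
  change gen a b c d 2 + gen a b c d 1 + -gen a b c d 2 +
    -(c • gen a b c d 0 + d • gen a b c d 1) = 0 at h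
  linear_combination (norm := module) (-1 : ℤ) • h

/-- The images of the generators. The quarter turn `(p, q) ↦ (q, -p)` conjugates `Uᵀ` into `U⁻¹`,
so it carries the row space of `U - 1` onto its column space. -/
def genImage (a b c d : ℤ) : Fin 3 → ℤ × Coker a b c d :=
  ![(0, Submodule.Quotient.mk ![0, -1]), (0, Submodule.Quotient.mk ![1, 0]), (1, 0)]

lemma lift_genImage_eq_one {a b c d : ℤ} (h : a * d - b * c = 1) :
    ∀ r ∈ torusBundleRels a b c d,
      FreeGroup.lift (fun i => Multiplicative.ofAdd (genImage a b c d i)) r = 1 := by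
  rintro r (rfl | rfl | rfl)
  · rw [map_mul, map_inv, mul_inv_eq_one, map_mul, map_mul, mul_comm]
  · rw [← toAdd_eq_zero]
    simp only [map_mul, map_inv, map_zpow, FreeGroup.lift_apply_of, toAdd_mul, toAdd_inv,
      toAdd_zpow, toAdd_ofAdd]
    simp only [genImage, Matrix.cons_val]
    ext1
    · simp
    · simp only [Prod.snd_add, Prod.snd_neg, Prod.smul_snd, Prod.snd_zero,
        ← Submodule.Quotient.mk_smul, ← Submodule.Quotient.mk_add, ← Submodule.Quotient.mk_neg,
        zero_add, neg_zero, add_zero]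
      rw [Submodule.Quotient.mk_eq_zero]
      refine ⟨![b, -a], ?_⟩
      ext i
      fin_cases i
      · simp; ring
      · simp; linear_combination (-h)
  · rw [← toAdd_eq_zero]
    simp only [map_mul, map_inv, map_zpow, FreeGroup.lift_apply_of, toAdd_mul, toAdd_inv,
      toAdd_zpow, toAdd_ofAdd]
    simp only [genImage, Matrix.cons_val]
    ext1
    · simp
    · simp only [Prod.snd_add, Prod.snd_neg, Prod.smul_snd, Prod.snd_zero,
        ← Submodule.Quotient.mk_smul, ← Submodule.Quotient.mk_add, ← Submodule.Quotient.mk_neg,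
        zero_add, neg_zero, add_zero]
      rw [Submodule.Quotient.mk_eq_zero]
      refine ⟨![d, -c], ?_⟩
      ext i
      fin_cases i
      · simp; linear_combination h
      · simp; ring

/-- The map from the abelianization to `ℤ × Coker`. -/
def toProd {a b c d : ℤ} (h : a * d - b * c = 1) :
    Additive (Abelianization (PresentedGroup (torusBundleRels a b c d))) →+
      ℤ × Coker a b c d :=
  MonoidHom.toAdditiveLeft
    (Abelianization.lift (PresentedGroup.toGroup (lift_genImage_eq_one h)))

lemma toProd_gen {a b c d : ℤ} (h : a * d - b * c = 1) (i : Fin 3) :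
    toProd h (gen a b c d i) = genImage a b c d i := by
  simp [toProd, gen]

/-- The linear map `(p, q) ↦ p y - q x` to the abelianization. -/
def fromPlane (a b c d : ℤ) : (Fin 2 → ℤ) →ₗ[ℤ]
    Additive (Abelianization (PresentedGroup (torusBundleRels a b c d))) :=
  Fintype.linearCombination ℤ ![gen a b c d 1, -gen a b c d 0]

lemma fromPlane_apply (a b c d : ℤ) (v : Fin 2 → ℤ) :
    fromPlane a b c d v = v 0 • gen a b c d 1 - v 1 • gen a b c d 0 := by
  simp [fromPlane, Fintype.linearCombination_apply, sub_eq_add_neg]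

lemma range_le_ker_fromPlane {a b c d : ℤ} (h : a * d - b * c = 1) :
    LinearMap.range (Matrix.toLin' (!![a, b; c, d] - 1)) ≤ LinearMap.ker (fromPlane a b c d) := by
  rintro _ ⟨v, rfl⟩
  have h₀ := gen_rel_zero a b c d
  have h₁ := gen_rel_one a b c d
  rw [LinearMap.mem_ker, fromPlane_apply, Matrix.toLin'_apply, Matrix.sub_mulVec,
    Matrix.one_mulVec]
  simp only [Pi.sub_apply, Matrix.mulVec, dotProduct, Fin.sum_univ_two, Matrix.of_apply,
    Matrix.cons_val]
  generalize gen a b c d 0 = x at *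
  generalize gen a b c d 1 = y at *
  have hd := congrArg (fun n : ℤ => n • (v 0 • y - v 1 • x)) h
  linear_combination (norm := module) (v 0 * c + v 1 * d) • h₀ - (v 0 * a + v 1 * b) • h₁ + hd

/-- The map from `ℤ × Coker` to the abelianization. -/
def ofProd {a b c d : ℤ} (h : a * d - b * c = 1) : ℤ × Coker a b c d →+
    Additive (Abelianization (PresentedGroup (torusBundleRels a b c d))) :=
  AddMonoidHom.coprod (zmultiplesHom _ (gen a b c d 2))
    (Submodule.liftQ _ (fromPlane a b c d) (range_le_ker_fromPlane h)).toAddMonoidHom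

lemma ofProd_mk {a b c d : ℤ} (h : a * d - b * c = 1) (n : ℤ) (v : Fin 2 → ℤ) :
    ofProd h (n, Submodule.Quotient.mk v) =
      n • gen a b c d 2 + (v 0 • gen a b c d 1 - v 1 • gen a b c d 0) := by
  rw [← fromPlane_apply]
  rfl

lemma ofProd_genImage {a b c d : ℤ} (h : a * d - b * c = 1) (i : Fin 3) :
    ofProd h (genImage a b c d i) = gen a b c d i := by
  fin_cases i
  · exact (ofProd_mk h 0 ![0, -1]).trans (by simp)
  · exact (ofProd_mk h 0 ![1, 0]).trans (by simp)
  · exact (ofProd_mk h 1 0).trans (by simp)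

lemma ofProd_toProd {a b c d : ℤ} (h : a * d - b * c = 1)
    (g : Additive (Abelianization (PresentedGroup (torusBundleRels a b c d)))) :
    ofProd h (toProd h g) = g := by
  have key : (AddMonoidHom.toMultiplicative ((ofProd h).comp (toProd h))).comp
      (Abelianization.of (G := PresentedGroup (torusBundleRels a b c d))) = Abelianization.of := by
    refine PresentedGroup.ext fun i => ?_
    change ofProd h (toProd h (gen a b c d i)) = gen a b c d i
    rw [toProd_gen, ofProd_genImage]
  obtain ⟨p, rfl⟩ : ∃ p, Additive.ofMul (Abelianization.of p) = g :=
    QuotientGroup.mk_surjective (Additive.toMul g)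
  exact DFunLike.congr_fun key p

lemma toProd_ofProd {a b c d : ℤ} (h : a * d - b * c = 1) (p : ℤ × Coker a b c d) :
    toProd h (ofProd h p) = p := by
  obtain ⟨n, q⟩ := p
  obtain ⟨v, rfl⟩ := Submodule.Quotient.mk_surjective _ q
  simp only [ofProd_mk, map_add, map_sub, map_zsmul, toProd_gen]
  simp only [genImage, Matrix.cons_val]
  ext1
  · simp
  · simp only [Prod.snd_add, Prod.snd_sub, Prod.smul_snd, smul_zero, zero_add,
      ← Submodule.Quotient.mk_smul, ← Submodule.Quotient.mk_sub]
    congr 1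
    ext i
    fin_cases i <;> simp

end torusBundleRels

open torusBundleRels in
theorem stmt_0 (a b c d : ℤ) (h : a * d - b * c = 1) :
    Nonempty (Additive (Abelianization (PresentedGroup
      ({FreeGroup.of 0 * FreeGroup.of 1 * (FreeGroup.of 1 * FreeGroup.of 0)⁻¹,
        FreeGroup.of 2 * FreeGroup.of 0 * (FreeGroup.of 2)⁻¹ *
          ((FreeGroup.of 0) ^ a * (FreeGroup.of 1) ^ b)⁻¹,
        FreeGroup.of 2 * FreeGroup.of 1 * (FreeGroup.of 2)⁻¹ *
          ((FreeGroup.of 0) ^ c * (FreeGroup.of 1) ^ d)⁻¹} :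
        Set (FreeGroup (Fin 3))))) ≃+
      ℤ × ((Fin 2 → ℤ) ⧸ LinearMap.range (Matrix.toLin' (!![a, b; c, d] - 1)))) :=
  ⟨{ toProd h with
      invFun := ofProd h
      left_inv := ofProd_toProd h
      right_inv := toProd_ofProd h }⟩
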